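/- arXiv:1406.0576 — 5 statements merged into one kernel-verified Lean document; each statement's English description precedes it below -/
import Mathlib

section
/- There exists an absolute constant c > 0 such that for every multi-unit combinatorial market with n consumers and m items, there exists a competitive bundling equilibrium whose welfare is at least c · OPT / (log(μ) + 2), where μ = min{n, m}. -/
open Finset

/-- A combinatorial market with `n` consumers and `m` items. Each consumer has a
normalized (`v i ∅ = 0`) and monotone valuation over subsets of items. -/
structure Market (n m : ℕ) where
  v : Fin n → Finset (Fin m) → ℝ
  v_empty : ∀ i, v i ∅ = 0
  v_mono : ∀ i, ∀ S T : Finset (Fin m), S ⊆ T → v i S ≤ v i T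

/-- An allocation assigns pairwise disjoint sets of items to consumers. -/
def IsAllocation {n m : ℕ} (S : Fin n → Finset (Fin m)) : Prop :=
  ∀ i j : Fin n, i ≠ j → Disjoint (S i) (S j)

/-- The welfare of an allocation. -/
def allocWelfare {n m : ℕ} (Mk : Market n m) (S : Fin n → Finset (Fin m)) : ℝ :=
  ∑ i, Mk.v i (S i)

/-- The optimal welfare over all allocations. -/
noncomputable def OPT {n m : ℕ} (Mk : Market n m) : ℝ :=
  sSup {w : ℝ | ∃ S : Fin n → Finset (Fin m), IsAllocation S ∧ allocWelfare Mk S = w}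

/-- A competitive bundling equilibrium: a partition of the items into nonempty bundles,
nonnegative bundle prices, and an assignment of every bundle to a consumer (market
clearance), such that every consumer's assigned set of bundles maximizes his profit
over all sets of bundles. -/
structure CBE {n m : ℕ} (Mk : Market n m) where
  bundles : Finset (Finset (Fin m))
  price : Finset (Fin m) → ℝ
  assign : Finset (Fin m) → Fin n
  bundles_nonempty : ∀ b ∈ bundles, b.Nonempty
  bundles_disjoint : ∀ b ∈ bundles, ∀ b' ∈ bundles, b ≠ b' → Disjoint b b'
  bundles_cover : bundles.biUnion id = Finset.univ
  price_nonneg : ∀ b ∈ bundles, 0 ≤ price b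
  profit_max : ∀ i : Fin n, ∀ T : Finset (Finset (Fin m)), T ⊆ bundles →
    Mk.v i ((bundles.filter fun b => assign b = i).biUnion id)
        - ∑ b ∈ bundles.filter fun b => assign b = i, price b
      ≥ Mk.v i (T.biUnion id) - ∑ b ∈ T, price b

/-- The welfare of a competitive bundling equilibrium. -/
def CBE.welfare {n m : ℕ} {Mk : Market n m} (E : CBE Mk) : ℝ :=
  ∑ i, Mk.v i ((E.bundles.filter fun b => E.assign b = i).biUnion id)

/-- The revenue of a competitive bundling equilibrium. -/
def CBE.revenue {n m : ℕ} {Mk : Market n m} (E : CBE Mk) : ℝ :=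
  ∑ b ∈ E.bundles, E.price b

/-- A market is multi-unit if valuations depend only on the number of items. -/
def MultiUnit {n m : ℕ} (Mk : Market n m) : Prop :=
  ∀ i, ∀ S T : Finset (Fin m), S.card = T.card → Mk.v i S = Mk.v i T

/-- Approximate state of the ascending process. -/
structure CBState {n m : ℕ} (Mk : Market n m) (B0 : Finset (Finset (Fin m))) (p0 ε : ℝ)
    (B : Finset (Finset (Fin m))) (p : Finset (Fin m) → ℝ)
    (a : Finset (Fin m) → Option (Fin n)) : Prop where
  ne : ∀ b ∈ B, b.Nonempty
  disj : ∀ b ∈ B, ∀ b' ∈ B, b ≠ b' → Disjoint b b'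
  cover : B.biUnion id = Finset.univ
  pnn : ∀ b ∈ B, 0 ≤ p b
  unsold : ∀ b ∈ B, a b = none → b ∈ B0 ∧ p b = p0
  uniq : ∀ i, ∀ b ∈ B, ∀ b' ∈ B, a b = some i → a b' = some i → b = b'
  ir : ∀ i, ∀ b ∈ B, a b = some i → p b ≤ Mk.v i b
  content : ∀ i, ∀ b ∈ B, a b = some i → ∀ T ⊆ B,
    Mk.v i (T.biUnion id) - ∑ c ∈ T, p c - ε ≤ Mk.v i b - p b
  card_le : #B ≤ #B0
  rev : #B0 * p0 ≤ ∑ b ∈ B, p b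

lemma v_nonneg' {n m : ℕ} (Mk : Market n m) (i : Fin n) (S : Finset (Fin m)) :
    0 ≤ Mk.v i S := by
  rw [← Mk.v_empty i]; exact Mk.v_mono i _ _ (Finset.empty_subset _)

lemma v_le_H {n m : ℕ} (Mk : Market n m) (i : Fin n) (S : Finset (Fin m)) :
    Mk.v i S ≤ ∑ j, Mk.v j univ :=
  (Mk.v_mono i _ _ (Finset.subset_univ _)).trans
    (Finset.single_le_sum (f := fun j => Mk.v j univ)
      (fun j _ => v_nonneg' Mk j _) (Finset.mem_univ i))

lemma CBState.price_le {n m : ℕ} {Mk : Market n m} {B0 : Finset (Finset (Fin m))} {p0 ε : ℝ}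
    (hp0 : 0 ≤ p0)
    {B : Finset (Finset (Fin m))} {p : Finset (Fin m) → ℝ} {a : Finset (Fin m) → Option (Fin n)}
    (S : CBState Mk B0 p0 ε B p a) : ∀ b ∈ B, p b ≤ p0 + ∑ j, Mk.v j univ := by
  intro b hb
  have hH : 0 ≤ ∑ j, Mk.v j univ := Finset.sum_nonneg fun j _ => v_nonneg' Mk j _
  rcases h : a b with _ | i
  · have := (S.unsold b hb h).2; linarith
  · have := S.ir i b hb h
    have := v_le_H Mk i b
    linarith

lemma CBState.step {n m : ℕ} {Mk : Market n m} {B0 : Finset (Finset (Fin m))} {p0 ε : ℝ}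
    (hε : 0 < ε)
    {B : Finset (Finset (Fin m))} {p : Finset (Fin m) → ℝ} {a : Finset (Fin m) → Option (Fin n)}
    (S : CBState Mk B0 p0 ε B p a) (i : Fin n) (hi : ∀ b ∈ B, a b ≠ some i)
    (T0 : Finset (Finset (Fin m))) (hT0 : T0 ⊆ B)
    (hgt0 : ε < Mk.v i (T0.biUnion id) - ∑ c ∈ T0, p c) :
    ∃ B' p' a', CBState Mk B0 p0 ε B' p' a' ∧ ∑ b ∈ B', p' b = ∑ b ∈ B, p b + ε := by
  obtain ⟨T, hTm, hmax⟩ := Finset.exists_max_image B.powerset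
    (fun T => Mk.v i (T.biUnion id) - ∑ c ∈ T, p c) ⟨T0, by simpa using hT0⟩
  have hT : T ⊆ B := by simpa using hTm
  have hgt : ε < Mk.v i (T.biUnion id) - ∑ c ∈ T, p c :=
    hgt0.trans_le (hmax T0 (by simpa using hT0))
  replace hmax : ∀ T' ⊆ B, Mk.v i (T'.biUnion id) - ∑ c ∈ T', p c
      ≤ Mk.v i (T.biUnion id) - ∑ c ∈ T, p c := fun T' h => hmax T' (by simpa using h)
  have hTne : T.Nonempty := by
    rw [Finset.nonempty_iff_ne_empty]
    rintro rfl
    simp [Mk.v_empty] at hgt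
    linarith
  set N := T.biUnion id with hN
  have hNdisj : ∀ b ∈ B \ T, Disjoint b N := by
    intro b hb
    rw [hN, Finset.disjoint_biUnion_right]
    intro c hc
    rw [Finset.mem_sdiff] at hb
    exact S.disj b hb.1 c (hT hc) (by rintro rfl; exact hb.2 hc)
  have hNne : N.Nonempty := by
    obtain ⟨t, ht⟩ := hTne
    obtain ⟨x, hx⟩ := S.ne t (hT ht)
    exact ⟨x, by rw [hN, Finset.mem_biUnion]; exact ⟨t, ht, hx⟩⟩
  have hNB : N ∉ B \ T := fun h => by
    have := hNdisj N h
    rw [disjoint_self] at this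
    exact hNne.ne_empty this
  have hneN : ∀ b ∈ B \ T, b ≠ N := fun b hb h => hNB (h ▸ hb)
  set p' : Finset (Fin m) → ℝ := Function.update p N (∑ c ∈ T, p c + ε) with hp'
  set a' : Finset (Fin m) → Option (Fin n) := Function.update a N (some i) with ha'
  have hpN : p' N = ∑ c ∈ T, p c + ε := by simp [hp']
  have haN : a' N = some i := by simp [ha']
  have hpo : ∀ b ∈ B \ T, p' b = p b := fun b hb => by simp [hp', hneN b hb]
  have hao : ∀ b ∈ B \ T, a' b = a b := fun b hb => by simp [ha', hneN b hb]
  have hsumT : 0 ≤ ∑ c ∈ T, p c := Finset.sum_nonneg fun c hc => S.pnn c (hT hc)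
  have hsum : ∑ b ∈ insert N (B \ T), p' b = ∑ b ∈ B, p b + ε := by
    rw [Finset.sum_insert hNB, hpN, Finset.sum_congr rfl hpo, ← Finset.sum_sdiff hT]; ring
  have hlift : ∀ T' ⊆ insert N (B \ T), ∃ T'' ⊆ B, T''.biUnion id = T'.biUnion id ∧
      ∑ c ∈ T'', p c ≤ ∑ c ∈ T', p' c := by
    intro T' hT'
    by_cases hNT : N ∈ T'
    · have hsub : T'.erase N ⊆ B \ T := by
        intro b hb
        rw [Finset.mem_erase] at hb
        have := hT' hb.2
        rw [Finset.mem_insert] at this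
        tauto
      refine ⟨T ∪ T'.erase N, Finset.union_subset hT (hsub.trans Finset.sdiff_subset), ?_, ?_⟩
      · conv_rhs => rw [← Finset.insert_erase hNT, Finset.biUnion_insert]
        rw [Finset.union_biUnion]; rfl
      · conv_rhs => rw [← Finset.insert_erase hNT, Finset.sum_insert (Finset.notMem_erase _ _)]
        rw [Finset.sum_union, hpN, Finset.sum_congr rfl (fun b hb => hpo b (hsub hb))]
        · linarith
        · exact (Finset.disjoint_sdiff).mono_right hsub
    · have hsub : T' ⊆ B \ T := by
        intro b hb
        have := hT' hb
        rw [Finset.mem_insert] at this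
        rcases this with rfl | h
        · exact absurd hb hNT
        · exact h
      exact ⟨T', hsub.trans Finset.sdiff_subset, rfl,
        (Finset.sum_congr rfl (fun b hb => hpo b (hsub hb))).ge⟩
  refine ⟨insert N (B \ T), p', a', ?_, hsum⟩
  have hBT : ∀ b ∈ B \ T, b ∈ B := fun b hb => Finset.sdiff_subset hb
  constructor
  · intro b hb
    rcases Finset.mem_insert.1 hb with rfl | hb
    · exact hNne
    · exact S.ne b (hBT b hb)
  · intro b hb b' hb' hne
    rcases Finset.mem_insert.1 hb with rfl | hb <;> rcases Finset.mem_insert.1 hb' with rfl | hb'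
    · exact absurd rfl hne
    · exact (hNdisj b' hb').symm
    · exact hNdisj b hb
    · exact S.disj b (hBT b hb) b' (hBT b' hb') hne
  · rw [Finset.biUnion_insert, ← S.cover]
    conv_rhs => rw [← Finset.union_sdiff_of_subset hT, Finset.union_biUnion]
    rfl
  · intro b hb
    rcases Finset.mem_insert.1 hb with rfl | hb
    · rw [hpN]; linarith
    · rw [hpo b hb]; exact S.pnn b (hBT b hb)
  · intro b hb hn
    rcases Finset.mem_insert.1 hb with rfl | hb
    · rw [haN] at hn; cases hn
    · rw [hao b hb] at hn; rw [hpo b hb]; exact S.unsold b (hBT b hb) hn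
  · intro h b hb b' hb' e e'
    rcases Finset.mem_insert.1 hb with rfl | hb <;> rcases Finset.mem_insert.1 hb' with rfl | hb'
    · rfl
    · rw [haN] at e; rw [hao b' hb'] at e'; cases e
      exact absurd e' (hi b' (hBT b' hb'))
    · rw [haN] at e'; rw [hao b hb] at e; cases e'
      exact absurd e (hi b (hBT b hb))
    · rw [hao b hb] at e; rw [hao b' hb'] at e'
      exact S.uniq h b (hBT b hb) b' (hBT b' hb') e e'
  · intro h b hb e
    rcases Finset.mem_insert.1 hb with rfl | hb
    · rw [haN] at e; cases e; rw [hpN]; linarith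
    · rw [hao b hb] at e; rw [hpo b hb]; exact S.ir h b (hBT b hb) e
  · intro h b hb e T' hT'
    obtain ⟨T'', h1, h2, h3⟩ := hlift T' hT'
    rw [← h2]
    rcases Finset.mem_insert.1 hb with rfl | hb
    · rw [haN] at e; cases e; rw [hpN]
      have := hmax T'' h1
      linarith
    · rw [hao b hb] at e; rw [hpo b hb]
      have := S.content h b (hBT b hb) e T'' h1
      linarith
  · have h1 := Finset.card_sdiff_add_card_eq_card hT
    have h2 := hTne.card_pos
    have h3 := S.card_le
    rw [Finset.card_insert_of_notMem hNB]
    omega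
  · rw [hsum]; have := S.rev; linarith

/-- Approximate equilibrium. -/
lemma approx_eq {n m : ℕ} (hn : 1 ≤ n) (Mk : Market n m) (B0 : Finset (Finset (Fin m)))
    (hne : ∀ b ∈ B0, b.Nonempty) (hdisj : ∀ b ∈ B0, ∀ b' ∈ B0, b ≠ b' → Disjoint b b')
    (hcov : B0.biUnion id = Finset.univ) (C : Finset (Fin n)) (hC : #B0 ≤ #C)
    (p0 ε : ℝ) (hp0 : 0 ≤ p0) (hε : 0 < ε)
    (hv : ∀ i ∈ C, ∀ b ∈ B0, p0 + ε < Mk.v i b) :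
    ∃ (B : Finset (Finset (Fin m))) (p : Finset (Fin m) → ℝ) (a : Finset (Fin m) → Fin n),
      (∀ b ∈ B, b.Nonempty) ∧ (∀ b ∈ B, ∀ b' ∈ B, b ≠ b' → Disjoint b b') ∧
      B.biUnion id = Finset.univ ∧ (∀ b ∈ B, p b ∈ Set.Icc 0 (p0 + ∑ j, Mk.v j univ)) ∧
      (#B0 * p0 ≤ ∑ b ∈ B, p b) ∧
      ∀ i, ∀ T ⊆ B, Mk.v i (T.biUnion id) - ∑ c ∈ T, p c - ε ≤
        Mk.v i ((B.filter fun b => a b = i).biUnion id) - ∑ b ∈ B.filter fun b => a b = i, p b := by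
  have hH : 0 ≤ ∑ j, Mk.v j univ := Finset.sum_nonneg fun j _ => v_nonneg' Mk j _
  let R : Set ℝ := {r | ∃ B p a, CBState Mk B0 p0 ε B p a ∧ ∑ b ∈ B, p b = r}
  have hRne : R.Nonempty := by
    refine ⟨_, B0, fun _ => p0, fun _ => none, ⟨hne, hdisj, hcov, fun _ _ => hp0,
      fun b hb _ => ⟨hb, rfl⟩, ?_, ?_, ?_, le_rfl, ?_⟩, rfl⟩
    · intro i b hb b' hb' h; cases h
    · intro i b hb h; cases h
    · intro i b hb h; cases h
    · simp
  have hRb : BddAbove R := by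
    refine ⟨#B0 * (p0 + ∑ j, Mk.v j univ), ?_⟩
    rintro r ⟨B, p, a, S, rfl⟩
    calc ∑ b ∈ B, p b ≤ ∑ b ∈ B, (p0 + ∑ j, Mk.v j univ) :=
          Finset.sum_le_sum (S.price_le hp0)
      _ = #B * (p0 + ∑ j, Mk.v j univ) := by rw [Finset.sum_const, nsmul_eq_mul]
      _ ≤ _ := by
        have : (#B : ℝ) ≤ #B0 := by exact_mod_cast S.card_le
        gcongr
  obtain ⟨r, ⟨B, p, a, S, rfl⟩, hr⟩ := exists_lt_of_lt_csSup hRne (show sSup R - ε < sSup R by linarith)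
  have hmax : ∀ i, (∀ b ∈ B, a b ≠ some i) → ∀ T ⊆ B,
      Mk.v i (T.biUnion id) - ∑ c ∈ T, p c ≤ ε := by
    intro i hi T hT
    by_contra! hlt
    obtain ⟨B', p', a', S', hs⟩ := S.step hε i hi T hT hlt
    have := le_csSup hRb ⟨B', p', a', S', rfl⟩
    linarith
  have hsold : ∀ b ∈ B, a b ≠ none := by
    intro b hb hbn
    obtain ⟨hb0, hpb⟩ := S.unsold b hb hbn
    have hex : ∀ i ∈ C, ∃ b' ∈ B, a b' = some i := by
      intro i hi
      by_contra! hcon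
      have h1 := hmax i hcon {b} (by simpa using hb)
      have h2 := hv i hi b hb0
      simp [hpb] at h1
      linarith
    choose! f hf1 hf2 using hex
    have hle : #C ≤ #(B.erase b) := by
      apply Finset.card_le_card_of_injOn f
      · intro i hi
        refine Finset.mem_coe.2 (Finset.mem_erase.2 ⟨?_, hf1 i hi⟩)
        intro h
        have := hf2 i hi
        rw [h, hbn] at this; cases this
      · intro i hi j hj hij
        have h1 := hf2 i hi
        have h2 := hf2 j hj
        rw [hij, h2] at h1
        exact (Option.some.inj h1).symm
    have h1 := Finset.card_erase_lt_of_mem hb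
    have h2 := S.card_le
    omega
  refine ⟨B, p, fun b => (a b).getD ⟨0, hn⟩, S.ne, S.disj, S.cover,
    fun b hb => ⟨S.pnn b hb, S.price_le hp0 b hb⟩, S.rev, ?_⟩
  intro i T hT
  have hiff : ∀ b ∈ B, ((a b).getD ⟨0, hn⟩ = i ↔ a b = some i) := by
    intro b hb
    rcases h : a b with _ | j
    · exact absurd h (hsold b hb)
    · simp
  rw [Finset.filter_congr hiff]
  by_cases hi : ∃ b ∈ B, a b = some i
  · obtain ⟨b, hb, hbi⟩ := hi
    have : B.filter (fun b => a b = some i) = {b} := by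
      ext c
      simp only [Finset.mem_filter, Finset.mem_singleton]
      constructor
      · rintro ⟨hc, hci⟩; exact S.uniq i c hc b hb hci hbi
      · rintro rfl; exact ⟨hb, hbi⟩
    rw [this]
    simpa using S.content i b hb hbi T hT
  · push Not at hi
    have : B.filter (fun b => a b = some i) = ∅ := by
      rw [Finset.filter_eq_empty_iff]; intro b hb; exact hi b hb
    rw [this]
    have := hmax i hi T hT
    simp [Mk.v_empty]
    linarith

lemma exact_eq {n m : ℕ} (hn : 1 ≤ n) (Mk : Market n m) (B0 : Finset (Finset (Fin m)))
    (hne : ∀ b ∈ B0, b.Nonempty) (hdisj : ∀ b ∈ B0, ∀ b' ∈ B0, b ≠ b' → Disjoint b b')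
    (hcov : B0.biUnion id = Finset.univ) (C : Finset (Fin n)) (hC : #B0 ≤ #C)
    (p0 : ℝ) (hp0 : 0 < p0)
    (hv : ∀ i ∈ C, ∀ b ∈ B0, 2 * p0 ≤ Mk.v i b) :
    ∃ E : CBE Mk, #B0 * p0 ≤ E.welfare := by
  have hεpos : ∀ N : ℕ, 0 < p0 / (N + 2) := fun N => by positivity
  have hεlt : ∀ N : ℕ, p0 / (N + 2) < p0 := fun N => by
    rw [div_lt_iff₀ (by positivity)]
    have : (0 : ℝ) ≤ N := by positivity
    nlinarith
  have key := fun N : ℕ => approx_eq hn Mk B0 hne hdisj hcov C hC p0 (p0 / (N + 2)) hp0.le (hεpos N)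
    (fun i hi b hb => by have := hv i hi b hb; have := hεlt N; linarith)
  choose B p a h1 h2 h3 h4 h5 h6 using key
  let U : Ultrafilter ℕ := Filter.hyperfilter ℕ
  have hU : (U : Filter ℕ) ≤ Filter.atTop := by
    rw [← Nat.cofinite_eq_atTop]; exact Filter.hyperfilter_le_cofinite
  obtain ⟨⟨B', a'⟩, hBa⟩ : ∃ x : Finset (Finset (Fin m)) × (Finset (Fin m) → Fin n),
      ∀ᶠ N in (U : Filter ℕ), (B N, a N) = x := by
    have hfin : (Set.univ : Set (Finset (Finset (Fin m)) × (Finset (Fin m) → Fin n))).Finite :=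
      Set.finite_univ
    have := (Ultrafilter.eventually_exists_mem_iff (f := U) hfin
      (P := fun x N => (B N, a N) = x)).1 (Filter.Eventually.of_forall fun N => ⟨_, trivial, rfl⟩)
    obtain ⟨x, _, hx⟩ := this
    exact ⟨x, hx⟩
  simp only [Prod.mk.injEq] at hBa
  have hlim : ∀ b, ∃ L : ℝ, b ∈ B' → Filter.Tendsto (fun N => p N b) U (nhds L) := by
    intro b
    by_cases hb : b ∈ B'
    · have hc : IsCompact (Set.Icc 0 (p0 + ∑ j, Mk.v j univ)) := isCompact_Icc
      obtain ⟨L, _, hL⟩ := hc.ultrafilter_le_nhds (U.map fun N => p N b) (by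
        rw [Filter.le_principal_iff]
        show ∀ᶠ N in (U : Filter ℕ), p N b ∈ _
        filter_upwards [hBa] with N hN
        exact h4 N b (hN.1 ▸ hb))
      exact ⟨L, fun _ => hL⟩
    · exact ⟨0, fun h => absurd h hb⟩
  choose q hq using hlim
  have hqs : ∀ T ⊆ B', Filter.Tendsto (fun N => ∑ b ∈ T, p N b) U (nhds (∑ b ∈ T, q b)) :=
    fun T hT => tendsto_finsetSum _ fun b hb => hq b (hT hb)
  have hε0 : Filter.Tendsto (fun N : ℕ => p0 / ((N : ℝ) + 2)) U (nhds 0) := by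
    refine Filter.Tendsto.mono_left ?_ hU
    exact tendsto_const_nhds.div_atTop
      (Filter.tendsto_atTop_add_const_right _ _ tendsto_natCast_atTop_atTop)
  have hprofit : ∀ i, ∀ T ⊆ B', Mk.v i (T.biUnion id) - ∑ c ∈ T, q c ≤
        Mk.v i ((B'.filter fun b => a' b = i).biUnion id)
          - ∑ b ∈ B'.filter fun b => a' b = i, q b := by
    intro i T hT
    have hl := (((hqs T hT).const_sub (Mk.v i (T.biUnion id))).sub hε0)
    have hr := (hqs (B'.filter fun b => a' b = i) (Finset.filter_subset _ _)).const_sub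
      (Mk.v i ((B'.filter fun b => a' b = i).biUnion id))
    rw [sub_zero] at hl
    refine le_of_tendsto_of_tendsto hl hr ?_
    filter_upwards [hBa] with N hN
    have := h6 N i T (hN.1 ▸ hT)
    rw [hN.1, hN.2] at this
    exact this
  obtain ⟨N, hN⟩ := hBa.exists
  have hrev : #B0 * p0 ≤ ∑ b ∈ B', q b := by
    refine ge_of_tendsto (hqs B' subset_rfl) ?_
    filter_upwards [hBa] with N hN
    have := h5 N
    rwa [hN.1] at this
  let E : CBE Mk :=
    { bundles := B', price := q, assign := a'
      bundles_nonempty := hN.1 ▸ h1 N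
      bundles_disjoint := hN.1 ▸ h2 N
      bundles_cover := hN.1 ▸ h3 N
      price_nonneg := fun b hb => by
        refine ge_of_tendsto (hq b hb) ?_
        filter_upwards [hBa] with N hN
        exact (h4 N b (hN.1 ▸ hb)).1
      profit_max := fun i T hT => hprofit i T hT }
  refine ⟨E, hrev.trans ?_⟩
  show _ ≤ ∑ i, Mk.v i ((B'.filter fun b => a' b = i).biUnion id)
  rw [← Finset.sum_fiberwise B' a' q]
  refine Finset.sum_le_sum fun i _ => ?_
  have := hprofit i ∅ (Finset.empty_subset _)
  simp [Mk.v_empty] at this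
  linarith

lemma harm_bound {α : Type*} [DecidableEq α] (x : α → ℝ) (k : ℕ) : ∀ A : Finset α, #A = k →
    ∑ i ∈ A, (1 : ℝ) / #{j ∈ A | x i ≤ x j} ≤ (harmonic k : ℝ) := by
  induction k with
  | zero => intro A hA; rw [Finset.card_eq_zero] at hA; subst hA; simp
  | succ k ih =>
    intro A hA
    obtain ⟨a, ha, hmin⟩ := Finset.exists_min_image A x (Finset.card_pos.1 (by omega))
    have hc : #(A.erase a) = k := by rw [Finset.card_erase_of_mem ha]; omega
    rw [← Finset.add_sum_erase _ _ ha, harmonic_succ]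
    have h1 : {j ∈ A | x a ≤ x j} = A := Finset.filter_true_of_mem hmin
    rw [h1, hA]
    have h2 := ih _ hc
    have h3 : ∑ i ∈ A.erase a, (1 : ℝ) / #{j ∈ A | x i ≤ x j} ≤
        ∑ i ∈ A.erase a, (1 : ℝ) / #{j ∈ A.erase a | x i ≤ x j} := by
      refine Finset.sum_le_sum fun i hi => ?_
      have hpos : 0 < #{j ∈ A.erase a | x i ≤ x j} :=
        Finset.card_pos.2 ⟨i, by simpa using hi⟩
      have hle : #{j ∈ A.erase a | x i ≤ x j} ≤ #{j ∈ A | x i ≤ x j} :=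
        Finset.card_le_card (Finset.filter_subset_filter _ (Finset.erase_subset _ _))
      apply one_div_le_one_div_of_le
      · exact_mod_cast hpos
      · exact_mod_cast hle
    push_cast at *
    rw [one_div]
    linarith

lemma multi_le {n m : ℕ} {Mk : Market n m} (hM : MultiUnit Mk) (i : Fin n)
    (S T : Finset (Fin m)) (h : #S ≤ #T) : Mk.v i S ≤ Mk.v i T := by
  obtain ⟨S', h1, h2⟩ := Finset.exists_subset_card_eq h
  rw [hM i S S' h2.symm]
  exact Mk.v_mono i _ _ h1

/-- Many consumers with a large value in an allocation give a good equilibrium. -/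
lemma class_eq {n m : ℕ} (hn : 1 ≤ n) (hm : 1 ≤ m) (Mk : Market n m) (hM : MultiUnit Mk)
    (S : Fin n → Finset (Fin m)) (hS : IsAllocation S) (V : ℝ) (hV : 0 < V)
    (A : Finset (Fin n)) (hA : A.Nonempty) (hAV : ∀ i ∈ A, V ≤ Mk.v i (S i)) :
    ∃ E : CBE Mk, #A * V / 4 ≤ E.welfare := by
  set k := (#A + 1) / 2 with hk
  have hApos := hA.card_pos
  have hk1 : 1 ≤ k := by omega
  have hsum : ∑ i ∈ A, #(S i) ≤ m := by
    rw [← Finset.card_biUnion (fun i _ j _ hij => hS i j hij)]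
    simpa using Finset.card_le_univ (A.biUnion S)
  have hcard1 : ∀ i ∈ A, 1 ≤ #(S i) := by
    intro i hi
    rw [Nat.one_le_iff_ne_zero]
    intro h0
    rw [Finset.card_eq_zero] at h0
    have := hAV i hi
    rw [h0, Mk.v_empty] at this
    linarith
  have hAm : #A ≤ m := by
    calc #A = ∑ i ∈ A, 1 := by simp
      _ ≤ ∑ i ∈ A, #(S i) := Finset.sum_le_sum hcard1
      _ ≤ m := hsum
  have hkm : k ≤ m := by omega
  obtain ⟨P, hPe, hPc⟩ := Finpartition.exists_equipartition_card_eq (univ : Finset (Fin m))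
    (n := k) (by omega) (by simpa using hkm)
  set C := A.filter (fun i => #(S i) ≤ m / k) with hCdef
  have hbig : #(A.filter (fun i => ¬ #(S i) ≤ m / k)) < k := by
    by_contra hge0
    have hge := not_lt.1 hge0
    have h1 : ∑ i ∈ A.filter (fun i => ¬ #(S i) ≤ m / k), (m / k + 1) ≤ m := by
      refine le_trans (Finset.sum_le_sum (g := fun i => #(S i)) ?_) (le_trans
        (Finset.sum_le_sum_of_subset (Finset.filter_subset _ _)) hsum)
      intro i hi
      have := (Finset.mem_filter.1 hi).2
      show _ ≤ #(S i)
      omega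
    rw [Finset.sum_const, smul_eq_mul] at h1
    have h2 : k * (m / k + 1) ≤ m := le_trans (Nat.mul_le_mul_right _ hge) h1
    have h3 := Nat.lt_mul_div_succ m (show 0 < k by omega)
    omega
  have hCk : k ≤ #C := by
    have := Finset.card_filter_add_card_filter_not (s := A) (fun i => #(S i) ≤ m / k)
    rw [← hCdef] at this
    omega
  obtain ⟨E, hE⟩ := exact_eq hn Mk P.parts (fun b hb => P.nonempty_of_mem_parts hb)
    (fun b hb b' hb' hne => P.disjoint hb hb' hne) (P.biUnion_parts) C (by omega) (V / 2)
    (by linarith) (by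
      intro i hi b hb
      have hi' := Finset.mem_filter.1 hi
      have h1 := hPe.average_le_card_part hb
      rw [hPc] at h1
      simp only [Finset.card_univ, Fintype.card_fin] at h1
      have h2 := multi_le hM i (S i) b (hi'.2.trans h1)
      have h3 := hAV i hi'.1
      linarith)
  refine ⟨E, le_trans ?_ hE⟩
  rw [hPc]
  have : (#A : ℝ) ≤ 2 * k := by
    have : #A ≤ 2 * k := by omega
    exact_mod_cast this
  nlinarith

/-- There is an absolute constant `c > 0` such that every multi-unit
market admits a CBE with welfare at least `c * OPT / (log₂ μ + 2)`, `μ = min n m`. -/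
theorem multi_unit_log_approx :
    ∃ c : ℝ, 0 < c ∧
      ∀ (n m : ℕ), 1 ≤ n → 1 ≤ m → ∀ (Mk : Market n m), MultiUnit Mk →
        ∃ E : CBE Mk,
          E.welfare ≥ c * OPT Mk / (Real.logb 2 (min n m : ℕ) + 2) := by
  refine ⟨1 / 4, by norm_num, ?_⟩
  intro n m hn hm Mk hM
  have hmu : 1 ≤ min n m := le_min hn hm
  have hlog : 0 ≤ Real.logb 2 (min n m : ℕ) :=
    Real.logb_nonneg (by norm_num) (by exact_mod_cast hmu)
  set R := {w : ℝ | ∃ S : Fin n → Finset (Fin m), IsAllocation S ∧ allocWelfare Mk S = w} with hR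
  have hfin : R.Finite := by
    refine (Set.finite_range (allocWelfare Mk)).subset ?_
    rintro w ⟨S, _, rfl⟩; exact ⟨S, rfl⟩
  have hne : R.Nonempty := ⟨_, fun _ => ∅, fun i j _ => Finset.disjoint_empty_left _, rfl⟩
  obtain ⟨S, hS, hSO⟩ : OPT Mk ∈ R := hne.csSup_mem hfin
  set x : Fin n → ℝ := fun i => Mk.v i (S i) with hx
  set A := Finset.univ.filter (fun i => 0 < x i) with hA
  by_cases hAe : A.Nonempty
  · obtain ⟨i, hi, hmax⟩ := Finset.exists_max_image A
      (fun i => (#{j ∈ A | x i ≤ x j} : ℝ) * x i) hAe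
    obtain ⟨E, hE⟩ := class_eq hn hm Mk hM S hS (x i) (Finset.mem_filter.1 hi).2
      {j ∈ A | x i ≤ x j} ⟨i, by simp [hi]⟩ (fun j hj => (Finset.mem_filter.1 hj).2)
    refine ⟨E, le_trans ?_ hE⟩
    set W := (#{j ∈ A | x i ≤ x j} : ℝ) * x i with hW
    have hWnn : 0 ≤ W := by
      have := (Finset.mem_filter.1 hi).2
      positivity
    have hcA : #A ≤ min n m := by
      refine le_min (by simpa using Finset.card_le_univ A) ?_
      have h1 : ∀ i ∈ A, 1 ≤ #(S i) := by
        intro i hi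
        rw [Nat.one_le_iff_ne_zero]
        intro h0
        rw [Finset.card_eq_zero] at h0
        have := (Finset.mem_filter.1 hi).2
        simp only [hx, h0, Mk.v_empty] at this
        linarith
      calc #A = ∑ i ∈ A, 1 := by simp
        _ ≤ ∑ i ∈ A, #(S i) := Finset.sum_le_sum h1
        _ = #(A.biUnion S) := (Finset.card_biUnion (fun i _ j _ hij => hS i j hij)).symm
        _ ≤ m := by simpa using Finset.card_le_univ (A.biUnion S)
    have hOle : OPT Mk ≤ W * (Real.logb 2 (min n m : ℕ) + 2) := by
      have e1 : OPT Mk = ∑ i ∈ A, x i := by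
        rw [← hSO, allocWelfare, hA, Finset.sum_filter]
        refine Finset.sum_congr rfl fun j _ => ?_
        split_ifs with h
        · rfl
        · exact le_antisymm (not_lt.1 h) (v_nonneg' Mk j _)
      have e2 : ∑ i ∈ A, x i ≤ ∑ j ∈ A, W * (1 / #{l ∈ A | x j ≤ x l}) := by
        refine Finset.sum_le_sum fun j hj => ?_
        have hpos : (0 : ℝ) < #{l ∈ A | x j ≤ x l} := by
          exact_mod_cast Finset.card_pos.2 ⟨j, by simp [hj]⟩
        rw [mul_one_div, le_div_iff₀ hpos, mul_comm]
        exact hmax j hj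
      rw [← Finset.mul_sum] at e2
      have e3 := harm_bound x _ A rfl
      have e4 := harmonic_le_one_add_log #A
      have e5 : Real.log #A ≤ Real.log (min n m : ℕ) :=
        Real.log_le_log (by exact_mod_cast hAe.card_pos) (by exact_mod_cast hcA)
      have e6 : Real.log (min n m : ℕ) ≤ Real.logb 2 (min n m : ℕ) := by
        rw [Real.logb, le_div_iff₀ (Real.log_pos (by norm_num))]
        have h0 : 0 ≤ Real.log (min n m : ℕ) := Real.log_nonneg (by exact_mod_cast hmu)
        have := Real.log_two_lt_d9
        nlinarith
      rw [e1]
      refine e2.trans (mul_le_mul_of_nonneg_left ?_ hWnn)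
      linarith
    rw [div_le_iff₀ (by linarith)]
    linarith
  · have hO : OPT Mk ≤ 0 := by
      rw [← hSO, allocWelfare]
      refine Finset.sum_nonpos fun i _ => ?_
      by_contra! h
      exact hAe ⟨i, by simp [hA, hx, h]⟩
    have hz : ∀ i T, Mk.v i T = 0 := by
      intro i T
      refine le_antisymm (le_trans ?_ hO) (v_nonneg' Mk i T)
      refine le_csSup hfin.bddAbove ⟨fun j => if j = i then T else ∅, ?_, ?_⟩
      · intro j l hjl
        by_cases hj : j = i
        · have : l ≠ i := fun h => hjl (hj.trans h.symm)
          simp [this]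
        · simp [hj]
      · rw [allocWelfare, Finset.sum_eq_single i]
        · simp
        · intro j _ hj; simp [hj, Mk.v_empty]
        · simp
    have : Nonempty (Fin m) := ⟨⟨0, hm⟩⟩
    refine ⟨{ bundles := {univ}, price := fun _ => 0, assign := fun _ => ⟨0, hn⟩,
              bundles_nonempty := by simp
              bundles_disjoint := by simp
              bundles_cover := by simp
              price_nonneg := by simp
              profit_max := by intro i T _; simp [hz] }, ?_⟩
    have h1 : 1 / 4 * OPT Mk / (Real.logb 2 (min n m : ℕ) + 2) ≤ 0 :=
      div_nonpos_of_nonpos_of_nonneg (by linarith) (by linarith)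
    refine le_trans h1 (Finset.sum_nonneg fun i _ => v_nonneg' Mk i _)
end

section
/- For every integer m ≥ 2 there exists a multi-unit combinatorial market with n = m consumers, all of whose valuations are subadditive, such that the optimal welfare OPT is at least the m-th harmonic number Σ_{i=1}^m 1/i, while every competitive bundling equilibrium has welfare at most 3. -/
open Finset

/-- Consumer `0` values any nonempty proper set at `1` and the full set at `2`; consumer `i > 0`
is unit demand with value `1/(i+1)`. -/
noncomputable def mulbVal (m : ℕ) (i : Fin m) (S : Finset (Fin m)) : ℝ :=
  if S.card = 0 then 0 else if i.val = 0 ∧ S.card = m then 2 else 1 / ((i.val : ℝ) + 1)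

lemma mulbVal_le (m : ℕ) (i : Fin m) (S : Finset (Fin m)) (h : ¬ (i.val = 0 ∧ S.card = m)) :
    mulbVal m i S ≤ 1 / ((i.val : ℝ) + 1) := by
  unfold mulbVal
  rw [if_neg h]
  split_ifs
  · positivity
  · exact le_rfl

lemma mulbVal_ne (m : ℕ) (i : Fin m) (S : Finset (Fin m)) (hi : i.val ≠ 0) (hS : S.Nonempty) :
    mulbVal m i S = 1 / ((i.val : ℝ) + 1) := by
  unfold mulbVal
  rw [if_neg hS.card_pos.ne', if_neg (fun h => hi h.1)]

lemma mulbVal_nonneg (m : ℕ) (i : Fin m) (S : Finset (Fin m)) : 0 ≤ mulbVal m i S := by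
  unfold mulbVal
  split_ifs <;> positivity

lemma mulbVal_mono (m : ℕ) (i : Fin m) (S T : Finset (Fin m)) (h : S ⊆ T) :
    mulbVal m i S ≤ mulbVal m i T := by
  have hc := Finset.card_le_card h
  have hT : T.card ≤ m := by simpa using Finset.card_le_univ T
  by_cases h0 : S.card = 0
  · have : mulbVal m i S = 0 := by unfold mulbVal; rw [if_pos h0]
    rw [this]; exact mulbVal_nonneg m i T
  · unfold mulbVal
    rw [if_neg h0, if_neg (by omega : ¬ T.card = 0)]
    split_ifs with h1 h2 h2
    · exact le_rfl
    · omega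
    · rw [h2.1]; norm_num
    · exact le_rfl

lemma mulbVal_subadd (m : ℕ) (i : Fin m) (S T : Finset (Fin m)) :
    mulbVal m i (S ∪ T) ≤ mulbVal m i S + mulbVal m i T := by
  rcases S.eq_empty_or_nonempty with rfl | hS
  · simpa using mulbVal_nonneg m i ∅
  rcases T.eq_empty_or_nonempty with rfl | hT
  · simpa using mulbVal_nonneg m i ∅
  have h1 := hS.card_pos.ne'
  have h2 := hT.card_pos.ne'
  have h3 : (S ∪ T).card ≠ 0 := (hS.mono Finset.subset_union_left).card_pos.ne'
  have h4 : (0 : ℝ) ≤ 1 / ((i.val : ℝ) + 1) := by positivity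
  unfold mulbVal
  rw [if_neg h1, if_neg h2, if_neg h3]
  by_cases hi : i.val = 0
  · simp only [hi]
    split_ifs <;> norm_num
  · simp only [hi, false_and, if_false]
    linarith

noncomputable def mulbMarket (m : ℕ) : Market m m where
  v := mulbVal m
  v_empty := fun i => by simp [mulbVal]
  v_mono := mulbVal_mono m

lemma mulb_opt (m : ℕ) (hm : 2 ≤ m) :
    OPT (mulbMarket m) ≥ ∑ i ∈ Finset.range m, (1 : ℝ) / (i + 1) := by
  unfold OPT
  apply le_csSup
  · apply Set.Finite.bddAbove
    apply (Set.finite_range (fun S : Fin m → Finset (Fin m) => allocWelfare (mulbMarket m) S)).subset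
    rintro w ⟨S, -, rfl⟩
    exact ⟨S, rfl⟩
  · refine ⟨fun i => {i}, ?_, ?_⟩
    · intro i j hij
      simpa using hij
    · rw [Finset.sum_range]
      unfold allocWelfare
      apply Finset.sum_congr rfl
      intro i _
      have : ¬ (i.val = 0 ∧ 1 = m) := by omega
      simp only [mulbMarket, mulbVal, Finset.card_singleton, if_neg this]
      simp

lemma mulb_cbe (m : ℕ) (hm : 2 ≤ m) (E : CBE (mulbMarket m)) : E.welfare ≤ 3 := by
  let z : Fin m := ⟨0, by omega⟩
  have hz : z.val = 0 := rfl
  let A : Fin m → Finset (Finset (Fin m)) := fun i => E.bundles.filter fun b => E.assign b = i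
  let P : Fin m → ℝ := fun i => ∑ b ∈ A i, E.price b
  have hpm : ∀ i, ∀ T : Finset (Finset (Fin m)), T ⊆ E.bundles →
      mulbVal m i ((A i).biUnion id) - P i ≥ mulbVal m i (T.biUnion id) - ∑ b ∈ T, E.price b :=
    E.profit_max
  have hA : ∀ i, ∀ b ∈ A i, b ∈ E.bundles ∧ E.assign b = i := by
    intro i b hb
    simpa [A] using hb
  have hne : ∀ i, (A i).Nonempty → ((A i).biUnion id).Nonempty := by
    rintro i ⟨b, hb⟩
    obtain ⟨x, hx⟩ := E.bundles_nonempty b (hA i b hb).1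
    exact ⟨x, Finset.mem_biUnion.2 ⟨b, hb, hx⟩⟩
  have hW : E.welfare = ∑ i, mulbVal m i ((A i).biUnion id) := rfl
  by_cases hall : ((A z).biUnion id).card = m
  · have hu : (A z).biUnion id = Finset.univ := by
      apply Finset.eq_univ_of_card
      simpa using hall
    have hoth : ∀ i, i ≠ z → A i = ∅ := by
      intro i hi
      by_contra hcon
      obtain ⟨b, hb⟩ := Finset.nonempty_iff_ne_empty.2 hcon
      obtain ⟨x, hx⟩ := E.bundles_nonempty b (hA i b hb).1
      have hxu : x ∈ (A z).biUnion id := by rw [hu]; exact Finset.mem_univ x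
      obtain ⟨b', hb', hx'⟩ := Finset.mem_biUnion.1 hxu
      have hbb : b ≠ b' := by
        rintro rfl
        exact hi ((hA i b hb).2.symm.trans (hA z b hb').2)
      exact Finset.disjoint_left.1
        (E.bundles_disjoint b (hA i b hb).1 b' (hA z b' hb').1 hbb) hx hx'
    rw [hW, Finset.sum_eq_single z]
    · unfold mulbVal
      rw [if_neg (by omega), if_pos ⟨hz, hall⟩]
      norm_num
    · intro i _ hi
      rw [hoth i hi]
      simp [mulbVal]
    · simp
  · exfalso
    have h0 := hpm z E.bundles (Finset.Subset.refl _)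
    rw [E.bundles_cover] at h0
    have hu2 : mulbVal m z Finset.univ = 2 := by
      unfold mulbVal
      rw [Finset.card_univ, Fintype.card_fin, if_neg (by omega), if_pos ⟨hz, rfl⟩]
    have hle := mulbVal_le m z ((A z).biUnion id) (fun h => hall h.2)
    rw [hz] at hle
    norm_num at hle
    have hsum : ∑ b ∈ E.bundles, E.price b = ∑ i, P i :=
      (Finset.sum_fiberwise E.bundles E.assign E.price).symm
    rw [← Finset.add_sum_erase Finset.univ P (Finset.mem_univ z)] at hsum
    have hge : 1 ≤ ∑ i ∈ Finset.univ.erase z, P i := by linarith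
    let W : Finset (Fin m) := (Finset.univ.erase z).filter fun i => (A i).Nonempty
    have hWs : ∑ i ∈ W, P i = ∑ i ∈ Finset.univ.erase z, P i := by
      apply Finset.sum_filter_of_ne
      intro i _ hP
      by_contra hcon
      rw [Finset.not_nonempty_iff_eq_empty] at hcon
      apply hP
      simp [P, hcon]
    rw [← hWs] at hge
    have hWne : W.Nonempty := by
      by_contra hcon
      rw [Finset.not_nonempty_iff_eq_empty] at hcon
      rw [hcon] at hge
      norm_num at hge
    have hWm : ∀ i ∈ W, i.val ≠ 0 ∧ (A i).Nonempty := by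
      intro i hi
      simp only [W, Finset.mem_filter, Finset.mem_erase] at hi
      exact ⟨fun h => hi.1.1 (Fin.ext h), hi.2⟩
    let j := W.max' hWne
    have hj : j ∈ W := W.max'_mem hWne
    have hcard : W.card ≤ j.val := by
      have : W ⊆ Finset.Ioc z j := by
        intro i hi
        rw [Finset.mem_Ioc]
        refine ⟨?_, W.le_max' i hi⟩
        rw [Fin.lt_def, hz]
        exact Nat.pos_of_ne_zero (hWm i hi).1
      have := Finset.card_le_card this
      rw [Fin.card_Ioc] at this
      omega
    have hPj : P j ≤ 1 / ((j.val : ℝ) + 1) := by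
      have := hpm j ∅ (Finset.empty_subset _)
      rw [mulbVal_ne m j _ (hWm j hj).1 (hne j (hWm j hj).2)] at this
      simp only [Finset.biUnion_empty, Finset.sum_empty] at this
      have := mulbVal_nonneg m j ∅
      linarith
    obtain ⟨b, hb⟩ := (hWm j hj).2
    have hbP : E.price b ≤ P j :=
      Finset.single_le_sum (f := E.price) (fun c hc => E.price_nonneg c (hA j c hc).1) hb
    have hPi : ∀ i ∈ W, P i ≤ 1 / ((j.val : ℝ) + 1) := by
      intro i hi
      have h := hpm i {b} (by simpa using (hA j b hb).1)
      rw [mulbVal_ne m i _ (hWm i hi).1 (hne i (hWm i hi).2), mulbVal_ne m i _ (hWm i hi).1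
        (by simpa using E.bundles_nonempty b (hA j b hb).1)] at h
      rw [Finset.sum_singleton] at h
      linarith
    have hfin := Finset.sum_le_card_nsmul W P _ hPi
    rw [nsmul_eq_mul, mul_one_div] at hfin
    have hlt : (W.card : ℝ) / ((j.val : ℝ) + 1) < 1 := by
      rw [div_lt_one (by positivity)]
      have : (W.card : ℝ) ≤ j.val := by exact_mod_cast hcard
      linarith
    linarith

/-- For every `m ≥ 2` there is a multi-unit market with `n = m` consumers
with subadditive valuations, where `OPT` is at least the `m`-th harmonic number while
every CBE has welfare at most `3`. -/
theorem multi_unit_log_lower_bound (m : ℕ) (hm : 2 ≤ m) :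
    ∃ Mk : Market m m, MultiUnit Mk ∧
      (∀ i, ∀ S T : Finset (Fin m), Mk.v i (S ∪ T) ≤ Mk.v i S + Mk.v i T) ∧
      OPT Mk ≥ ∑ i ∈ Finset.range m, (1 : ℝ) / (i + 1) ∧
      ∀ E : CBE Mk, E.welfare ≤ 3 := by
  refine ⟨mulbMarket m, ?_, mulbVal_subadd m, mulb_opt m hm, mulb_cbe m hm⟩
  intro i S T h
  simp only [mulbMarket, mulbVal, h]
end

section
/- For every combinatorial market with n = 2 consumers whose valuations are both subadditive, there exists a competitive bundling equilibrium whose welfare equals the optimal welfare OPT. -/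
open Finset

lemma opt_eq_aux {m : ℕ} (Mk : Market 2 m) (X : Finset (Fin m))
    (hX : ∀ Y : Finset (Fin m), Mk.v 0 Y + Mk.v 1 Yᶜ ≤ Mk.v 0 X + Mk.v 1 Xᶜ) :
    OPT Mk = Mk.v 0 X + Mk.v 1 Xᶜ := by
  apply IsGreatest.csSup_eq
  constructor
  · refine ⟨![X, Xᶜ], ?_, ?_⟩
    · intro i j hij
      fin_cases i <;> fin_cases j
      · exact absurd rfl hij
      · exact disjoint_compl_right
      · exact disjoint_compl_left
      · exact absurd rfl hij
    · simp [allocWelfare, Fin.sum_univ_two]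
  · rintro w ⟨S, hS, rfl⟩
    have h1 : S 1 ⊆ (S 0)ᶜ := by
      have := hS 0 1 (by decide)
      exact (le_compl_iff_disjoint_left (a := S 1) (b := S 0)).2 this
    have h2 := Mk.v_mono 1 _ _ h1
    have h3 := hX (S 0)
    simp only [allocWelfare, Fin.sum_univ_two]
    linarith

lemma single_bundle {m : ℕ} (hm : 1 ≤ m) (Mk : Market 2 m) (j : Fin 2)
    (hj : ∀ i, Mk.v i univ ≤ Mk.v j univ) :
    ∃ E : CBE Mk, E.welfare = Mk.v j univ := by
  have h0 : 0 ≤ Mk.v j univ := by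
    have := Mk.v_mono j ∅ univ (subset_univ _)
    rwa [Mk.v_empty] at this
  refine ⟨⟨{univ}, fun _ => Mk.v j univ, fun _ => j, ?_, ?_, ?_, ?_, ?_⟩, ?_⟩
  · intro b hb
    rw [mem_singleton.1 hb]
    exact ⟨⟨0, hm⟩, mem_univ _⟩
  · intro b hb b' hb' h
    exact absurd ((mem_singleton.1 hb).trans (mem_singleton.1 hb').symm) h
  · simp
  · intro b hb
    exact h0
  · intro i T hT
    have hi := hj i
    rcases subset_singleton_iff.1 hT with rfl | rfl <;>
    by_cases hij : j = i
    · subst hij; simp [filter_singleton, Mk.v_empty]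
    · simp [filter_singleton, hij, Mk.v_empty]
    · subst hij; simp [filter_singleton]
    · simp [filter_singleton, hij, Mk.v_empty]; exact hi
  · simp only [CBE.welfare]
    rw [Fintype.sum_eq_single j]
    · simp [filter_singleton]
    · intro i hij
      simp [filter_singleton, Ne.symm hij, Mk.v_empty]

lemma two_bundle {m : ℕ} (Mk : Market 2 m) (X Y : Finset (Fin m))
    (hXY : Disjoint X Y) (hU : X ∪ Y = univ) (hXn : X.Nonempty) (hYn : Y.Nonempty)
    (p q : ℝ) (hp : 0 ≤ p) (hq : 0 ≤ q)
    (a1 : p ≤ Mk.v 0 X) (a2 : Mk.v 0 Y - q ≤ Mk.v 0 X - p) (a3 : Mk.v 0 univ - q ≤ Mk.v 0 X)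
    (b1 : q ≤ Mk.v 1 Y) (b2 : Mk.v 1 X - p ≤ Mk.v 1 Y - q) (b3 : Mk.v 1 univ - p ≤ Mk.v 1 Y) :
    ∃ E : CBE Mk, E.welfare = Mk.v 0 X + Mk.v 1 Y := by
  have hne : X ≠ Y := by
    rintro rfl
    exact hXn.ne_empty (disjoint_self.1 hXY)
  have hf0 : (({X, Y} : Finset (Finset (Fin m))).filter
      fun b => (if b = X then (0 : Fin 2) else 1) = 0) = {X} := by
    ext b; simp only [mem_filter, mem_insert, mem_singleton]
    by_cases h : b = X <;> simp [h]
  have hf1 : (({X, Y} : Finset (Finset (Fin m))).filter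
      fun b => (if b = X then (0 : Fin 2) else 1) = 1) = {Y} := by
    ext b; simp only [mem_filter, mem_insert, mem_singleton]
    by_cases h : b = X <;> simp [h, hne]
  refine ⟨⟨{X, Y}, fun b => if b = X then p else q, fun b => if b = X then 0 else 1,
    ?_, ?_, ?_, ?_, ?_⟩, ?_⟩
  · intro b hb
    rcases mem_insert.1 hb with rfl | hb
    · exact hXn
    · rw [mem_singleton.1 hb]; exact hYn
  · intro b hb b' hb' h
    simp only [mem_insert, mem_singleton] at hb hb'
    rcases hb with rfl | rfl <;> rcases hb' with rfl | rfl
    · exact absurd rfl h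
    · exact hXY
    · exact hXY.symm
    · exact absurd rfl h
  · simpa using hU
  · intro b hb
    split_ifs <;> assumption
  · intro i T hT
    have hT4 : T = ∅ ∨ T = {X} ∨ T = {Y} ∨ T = {X, Y} := by
      have : T ∈ ({X, Y} : Finset (Finset (Fin m))).powerset := mem_powerset.2 hT
      by_cases hx : X ∈ T <;> by_cases hy : Y ∈ T
      · right; right; right
        exact Subset.antisymm hT (by intro b; simp; rintro (rfl | rfl) <;> assumption)
      · right; left
        ext b; have := @hT b; simp at this ⊢; grind
      · right; right; left
        ext b; have := @hT b; simp at this ⊢; grind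
      · left
        ext b; have := @hT b; simp at this ⊢; grind
    have hi : i = 0 ∨ i = 1 := by fin_cases i <;> simp
    rcases hi with rfl | rfl
    · rw [hf0]
      rcases hT4 with rfl | rfl | rfl | rfl <;>
        simp [Mk.v_empty, hne, hne.symm, sum_pair, hU] <;> linarith
    · rw [hf1]
      rcases hT4 with rfl | rfl | rfl | rfl <;>
        simp [Mk.v_empty, hne, hne.symm, sum_pair, hU] <;> linarith
  · simp only [CBE.welfare, Fin.sum_univ_two]
    rw [hf0, hf1]
    simp

/-- Every market with two subadditive consumers admits a CBE whose
welfare equals the optimal welfare. -/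
theorem two_subadditive_consumers_efficient (m : ℕ) (hm : 1 ≤ m) (Mk : Market 2 m)
    (hsub : ∀ i, ∀ S T : Finset (Fin m), Mk.v i (S ∪ T) ≤ Mk.v i S + Mk.v i T) :
    ∃ E : CBE Mk, E.welfare = OPT Mk := by
  obtain ⟨X, hX⟩ := Finite.exists_max (fun Y : Finset (Fin m) => Mk.v 0 Y + Mk.v 1 Yᶜ)
  rw [opt_eq_aux Mk X hX]
  have hsw := hX Xᶜ
  have hun := hX univ
  have hem := hX ∅
  simp only [compl_compl, compl_univ, compl_empty, Mk.v_empty] at hsw hun hem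
  rcases X.eq_empty_or_nonempty with rfl | hXn
  · simp only [compl_empty, Mk.v_empty] at *
    obtain ⟨E, hE⟩ := single_bundle hm Mk 1 (by
      intro i
      have hi : i = 0 ∨ i = 1 := by fin_cases i <;> simp
      rcases hi with rfl | rfl <;> linarith)
    exact ⟨E, by rw [hE]; ring⟩
  rcases (Xᶜ).eq_empty_or_nonempty with hc | hYn
  · have hXu : X = univ := by simpa using hc
    subst hXu
    simp only [compl_univ, Mk.v_empty] at *
    obtain ⟨E, hE⟩ := single_bundle hm Mk 0 (by
      intro i
      have hi : i = 0 ∨ i = 1 := by fin_cases i <;> simp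
      rcases hi with rfl | rfl <;> linarith)
    exact ⟨E, by rw [hE]; ring⟩
  have hU : X ∪ Xᶜ = univ := union_compl X
  have s0 := hsub 0 X Xᶜ
  have s1 := hsub 1 X Xᶜ
  rw [hU] at s0 s1
  have m0 := Mk.v_mono 0 X univ (subset_univ _)
  have m1 := Mk.v_mono 1 Xᶜ univ (subset_univ _)
  obtain ⟨p, hp1, hp2, hp3⟩ : ∃ p : ℝ, Mk.v 1 univ - Mk.v 1 Xᶜ ≤ p ∧
      Mk.v 0 univ - Mk.v 0 X - (Mk.v 0 Xᶜ - Mk.v 0 X) ≤ p ∧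
      (p = Mk.v 1 univ - Mk.v 1 Xᶜ ∨ p = Mk.v 0 univ - Mk.v 0 X - (Mk.v 0 Xᶜ - Mk.v 0 X)) :=
    ⟨_, le_max_left _ _, le_max_right _ _, max_choice _ _⟩
  refine two_bundle Mk X Xᶜ disjoint_compl_right hU hXn hYn p (p + (Mk.v 0 Xᶜ - Mk.v 0 X))
    ?_ ?_ ?_ ?_ ?_ ?_ ?_ ?_ <;> rcases hp3 with h | h <;> linarith
end

section
/- For every combinatorial market with n = 2 consumers (with arbitrary monotone normalized valuations), there exists a competitive bundling equilibrium whose welfare is at least (2/3) · OPT. -/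
open Finset

/-- The grand bundle sold to the consumer who values it most is a CBE. -/
lemma grand_bundle {m : ℕ} (hm : 1 ≤ m) (Mk : Market 2 m) (i : Fin 2)
    (hi : ∀ j, Mk.v j univ ≤ Mk.v i univ) :
    ∃ E : CBE Mk, E.welfare = Mk.v i univ := by
  have hne : (univ : Finset (Fin m)).Nonempty := ⟨⟨0, hm⟩, mem_univ _⟩
  have hnn : 0 ≤ Mk.v i univ := by
    rw [← Mk.v_empty i]; exact Mk.v_mono i _ _ (subset_univ _)
  have hf : ∀ j, (({univ} : Finset (Finset (Fin m))).filter fun _ => i = j)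
      = if i = j then {univ} else ∅ := by
    intro j; split_ifs with h <;> simp [h]
  refine ⟨⟨{univ}, fun _ => Mk.v i univ, fun _ => i, ?_, ?_, ?_, ?_, ?_⟩, ?_⟩
  · intro b hb; rw [mem_singleton] at hb; rw [hb]; exact hne
  · intro b hb c hc hbc
    rw [mem_singleton] at hb hc; exact absurd (hb.trans hc.symm) hbc
  · simp
  · intro b _; exact hnn
  · intro j T hT
    rw [hf j]
    have := hi j
    rcases subset_singleton_iff.mp hT with rfl | rfl
    · split_ifs with h
      · subst h; simp [Mk.v_empty]
      · simp [Mk.v_empty]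
    · split_ifs with h
      · subst h; simp
      · simp [Mk.v_empty]; linarith
  · unfold CBE.welfare
    simp only [hf]
    fin_cases i <;> simp [Fin.sum_univ_two, Mk.v_empty]

/-- A two-bundle CBE from suitable prices. -/
lemma two_bundles {m : ℕ} (Mk : Market 2 m) (S : Finset (Fin m))
    (hS : S.Nonempty) (hT : Sᶜ.Nonempty) (p q : ℝ) (hp : 0 ≤ p) (hq : 0 ≤ q)
    (h1 : p ≤ Mk.v 0 S) (h2 : Mk.v 0 Sᶜ - q ≤ Mk.v 0 S - p)
    (h3 : Mk.v 0 univ - Mk.v 0 S ≤ q)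
    (k1 : q ≤ Mk.v 1 Sᶜ) (k2 : Mk.v 1 S - p ≤ Mk.v 1 Sᶜ - q)
    (k3 : Mk.v 1 univ - Mk.v 1 Sᶜ ≤ p) :
    ∃ E : CBE Mk, E.welfare = Mk.v 0 S + Mk.v 1 Sᶜ := by
  have hne : Sᶜ ≠ S := by
    intro h
    obtain ⟨x, hx⟩ := hS
    have : x ∈ Sᶜ := by rw [h]; exact hx
    exact (mem_compl.mp this) hx
  have f0 : (({S, Sᶜ} : Finset (Finset (Fin m))).filter
      fun b => (if b = S then (0 : Fin 2) else 1) = 0) = {S} := by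
    rw [filter_insert, filter_singleton]; simp [hne]
  have f1 : (({S, Sᶜ} : Finset (Finset (Fin m))).filter
      fun b => (if b = S then (0 : Fin 2) else 1) = 1) = {Sᶜ} := by
    rw [filter_insert, filter_singleton]; simp [hne]
  refine ⟨⟨{S, Sᶜ}, fun b => if b = S then p else q, fun b => if b = S then 0 else 1,
    ?_, ?_, ?_, ?_, ?_⟩, ?_⟩
  · intro b hb
    rw [mem_insert, mem_singleton] at hb
    rcases hb with rfl | rfl <;> assumption
  · intro b hb c hc hbc
    rw [mem_insert, mem_singleton] at hb hc
    rcases hb with rfl | rfl <;> rcases hc with rfl | rfl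
    · exact absurd rfl hbc
    · exact disjoint_compl_right
    · exact disjoint_compl_left
    · exact absurd rfl hbc
  · simp
  · intro b _; show (0 : ℝ) ≤ if b = S then p else q; split_ifs <;> assumption
  · intro j T hT
    have hT' : T = ∅ ∨ T = {S} ∨ T = {Sᶜ} ∨ T = {S, Sᶜ} := by
      have := mem_powerset.mpr hT
      rw [powerset_insert] at this
      simp only [mem_union, mem_powerset, mem_image, subset_singleton_iff] at this
      rcases this with (h | h) | ⟨a, rfl | rfl, rfl⟩
      · exact Or.inl h
      · exact Or.inr (Or.inr (Or.inl h))
      · right; left; simp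
      · right; right; right; rfl
    have e : ∑ b ∈ ({S, Sᶜ} : Finset (Finset (Fin m))), (if b = S then p else q) = p + q := by
      rw [sum_pair hne.symm]; simp [hne]
    have u : ({S, Sᶜ} : Finset (Finset (Fin m))).biUnion id = univ := by simp
    fin_cases j
    · dsimp only [Fin.zero_eta]
      rw [f0]
      rcases hT' with rfl | rfl | rfl | rfl
      · simp [Mk.v_empty]; linarith
      · simp
      · simp [hne]; linarith
      · rw [e, u]; simp; linarith
    · dsimp only [Fin.mk_one]
      rw [f1]
      rcases hT' with rfl | rfl | rfl | rfl
      · simp [Mk.v_empty, hne]; linarith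
      · simp [hne]; linarith
      · simp
      · rw [e, u]; simp [hne]; linarith
  · unfold CBE.welfare
    rw [Fin.sum_univ_two]
    exact (congrArg₂ (fun A B : Finset (Finset (Fin m)) =>
      Mk.v 0 (A.biUnion id) + Mk.v 1 (B.biUnion id)) f0 f1).trans (by simp)

/-- Every market with two (arbitrary monotone normalized) consumers admits
a CBE whose welfare is at least `(2/3) * OPT`. -/
theorem two_consumers_two_thirds (m : ℕ) (hm : 1 ≤ m) (Mk : Market 2 m) :
    ∃ E : CBE Mk, E.welfare ≥ (2 / 3) * OPT Mk := by
  obtain ⟨S, -, hS⟩ := exists_max_image (univ : Finset (Finset (Fin m)))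
    (fun S => Mk.v 0 S + Mk.v 1 Sᶜ) ⟨∅, mem_univ _⟩
  have hopt : OPT Mk ≤ Mk.v 0 S + Mk.v 1 Sᶜ := by
    apply csSup_le
    · exact ⟨_, fun _ => ∅, fun _ _ _ => disjoint_empty_left _, rfl⟩
    · rintro w ⟨A, hA, rfl⟩
      unfold allocWelfare
      rw [Fin.sum_univ_two]
      have h01 := hA 0 1 (by decide)
      have : A 1 ⊆ (A 0)ᶜ := by
        exact h01.symm.le_compl_right
      have := Mk.v_mono 1 _ _ this
      have := hS (A 0) (mem_univ _)
      linarith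
  have swap := hS Sᶜ (mem_univ _)
  rw [compl_compl] at swap
  have nn : ∀ i A, 0 ≤ Mk.v i A := fun i A => by
    rw [← Mk.v_empty i]; exact Mk.v_mono i _ _ (empty_subset _)
  have le : ∀ i A, Mk.v i A ≤ Mk.v i univ := fun i A => Mk.v_mono i _ _ (subset_univ _)
  -- large grand bundle
  by_cases hbig : (2 / 3) * (Mk.v 0 S + Mk.v 1 Sᶜ) ≤ max (Mk.v 0 univ) (Mk.v 1 univ)
  · rcases le_total (Mk.v 0 univ) (Mk.v 1 univ) with h | h
    · obtain ⟨E, hE⟩ := grand_bundle hm Mk 1 (by intro j; fin_cases j <;> simp [h])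
      rw [max_eq_right h] at hbig
      exact ⟨E, by linarith⟩
    · obtain ⟨E, hE⟩ := grand_bundle hm Mk 0 (by intro j; fin_cases j <;> simp [h])
      rw [max_eq_left h] at hbig
      exact ⟨E, by linarith⟩
  rw [not_le, max_lt_iff] at hbig
  obtain ⟨ha, hb⟩ := hbig
  have l1 := le 0 S
  have l2 := le 0 Sᶜ
  have l3 := le 1 S
  have l4 := le 1 Sᶜ
  have n1 := nn 0 S
  have n2 := nn 0 Sᶜ
  have n3 := nn 1 S
  have n4 := nn 1 Sᶜ
  have hSne : S.Nonempty := by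
    rw [nonempty_iff_ne_empty]; intro h
    have : Mk.v 0 S = 0 := by rw [h, Mk.v_empty]
    linarith
  have hTne : Sᶜ.Nonempty := by
    rw [nonempty_iff_ne_empty]; intro h
    have : Mk.v 1 Sᶜ = 0 := by rw [h, Mk.v_empty]
    linarith
  have key : ∃ E : CBE Mk, E.welfare = Mk.v 0 S + Mk.v 1 Sᶜ := by
    by_cases c1 : Mk.v 1 S ≤ Mk.v 1 univ - Mk.v 1 Sᶜ
    · apply two_bundles Mk S hSne hTne (Mk.v 1 univ - Mk.v 1 Sᶜ) (Mk.v 1 Sᶜ) <;> linarith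
    · by_cases c2 : Mk.v 1 S ≤ Mk.v 0 S
      · apply two_bundles Mk S hSne hTne (Mk.v 1 S) (Mk.v 1 Sᶜ) <;> linarith
      · apply two_bundles Mk S hSne hTne (Mk.v 0 S) (Mk.v 0 S - Mk.v 1 S + Mk.v 1 Sᶜ) <;> linarith
  obtain ⟨E, hE⟩ := key
  exact ⟨E, by linarith⟩
end

section
/- Let v > 0 and let (S_1, …, S_r), with 1 ≤ r ≤ n, be pairwise disjoint nonempty subsets of M such that v_i(S_i) ∈ [v, 2v) for every i ∈ {1, …, r}. Then there exists a competitive bundling equilibrium whose welfare is at least (Σ_{i=1}^r v_i(S_i)) / (4√r + 4). -/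
open Finset

/-- State of the ascending auction with merging: `β` bundles, `p` prices, `h` holders. -/
structure AucState {n m : ℕ} (Mk : Market n m) (k : ℕ) (v p0 ε : ℝ)
    (β : Finset (Finset (Fin m))) (p : Finset (Fin m) → ℝ)
    (h : Finset (Fin m) → Option (Fin n)) : Prop where
  ne : ∀ b ∈ β, b.Nonempty
  dis : ∀ b ∈ β, ∀ b' ∈ β, b ≠ b' → Disjoint b b'
  cov : β.biUnion id = Finset.univ
  pnn : ∀ b ∈ β, 0 ≤ p b
  tot : k * p0 ≤ ∑ b ∈ β, p b
  crd : β.card ≤ k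
  unh : ∀ b ∈ β, h b = none → p b = p0 ∧ k ≤ (univ.filter fun j => v ≤ Mk.v j b).card
  inj : ∀ b ∈ β, ∀ b' ∈ β, ∀ i, h b = some i → h b' = some i → b = b'
  opt : ∀ b ∈ β, ∀ i, h b = some i → ∀ T ⊆ β,
    Mk.v i (T.biUnion id) - ∑ c ∈ T, p c ≤ Mk.v i b - p b + ε

lemma Market.nonneg {n m : ℕ} (Mk : Market n m) (i : Fin n) (T : Finset (Fin m)) :
    0 ≤ Mk.v i T := by
  have := Mk.v_mono i ∅ T (empty_subset _)
  rwa [Mk.v_empty] at this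

lemma AucState.bound {n m : ℕ} {Mk : Market n m} {k : ℕ} {v p0 ε : ℝ} (hp0 : 0 ≤ p0) (hε : 0 ≤ ε)
    {β : Finset (Finset (Fin m))} {p : Finset (Fin m) → ℝ}
    {h : Finset (Fin m) → Option (Fin n)} (A : AucState Mk k v p0 ε β p h) :
    ∀ b ∈ β, p b ≤ p0 + ε + ∑ i, Mk.v i univ := by
  intro b hb
  have hs : 0 ≤ ∑ i, Mk.v i univ := sum_nonneg fun i _ => Mk.nonneg i _
  cases hh : h b with
  | none => rw [(A.unh b hb hh).1]; linarith
  | some i =>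
    have h1 := A.opt b hb i hh ∅ (empty_subset _)
    simp [Mk.v_empty] at h1
    have h2 := Mk.v_mono i b univ (subset_univ _)
    have h3 : Mk.v i univ ≤ ∑ i, Mk.v i univ :=
      single_le_sum (f := fun i => Mk.v i univ) (fun i _ => Mk.nonneg i _) (mem_univ i)
    linarith

lemma AucState.step {n m : ℕ} {Mk : Market n m} {k : ℕ} {v p0 ε : ℝ} (hε : 0 < ε)
    {β : Finset (Finset (Fin m))} {p : Finset (Fin m) → ℝ}
    {h : Finset (Fin m) → Option (Fin n)} (A : AucState Mk k v p0 ε β p h)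
    (j : Fin n) (hj : ∀ b ∈ β, h b ≠ some j) (T : Finset (Finset (Fin m))) (hT : T ⊆ β)
    (hTne : T.Nonempty)
    (hmax : ∀ T' ⊆ β, Mk.v j (T'.biUnion id) - ∑ c ∈ T', p c
      ≤ Mk.v j (T.biUnion id) - ∑ c ∈ T, p c) :
    ∃ β' p' h', AucState Mk k v p0 ε β' p' h' ∧ ∑ b ∈ β', p' b = ∑ b ∈ β, p b + ε := by
  classical
  set N := T.biUnion id with hN
  have hNe : N.Nonempty := by
    obtain ⟨b, hb⟩ := hTne
    obtain ⟨x, hx⟩ := A.ne b (hT hb)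
    exact ⟨x, mem_biUnion.2 ⟨b, hb, hx⟩⟩
  have hdN : ∀ b ∈ β \ T, Disjoint b N := by
    intro b hb
    rw [mem_sdiff] at hb
    rw [hN, disjoint_biUnion_right]
    intro c hc
    exact A.dis b hb.1 c (hT hc) (by rintro rfl; exact hb.2 hc)
  have hbN : ∀ b ∈ β \ T, b ≠ N := by
    rintro b hb rfl
    have := hdN _ hb
    rw [disjoint_self_iff_empty] at this
    exact hNe.ne_empty this
  have hNn : N ∉ β \ T := fun hh => hbN N hh rfl
  set p' := Function.update p N (∑ c ∈ T, p c + ε) with hp'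
  set h' := Function.update h N (some j) with hh'
  have p'N : p' N = ∑ c ∈ T, p c + ε := by simp [hp']
  have p'b : ∀ b ∈ β \ T, p' b = p b := fun b hb => by simp [hp', hbN b hb]
  have h'N : h' N = some j := by simp [hh']
  have h'b : ∀ b ∈ β \ T, h' b = h b := fun b hb => by simp [hh', hbN b hb]
  have sumsplit : ∑ b ∈ β \ T, p b + ∑ c ∈ T, p c = ∑ b ∈ β, p b := sum_sdiff hT
  have hsum : ∑ b ∈ insert N (β \ T), p' b = ∑ b ∈ β, p b + ε := by
    rw [sum_insert hNn, p'N, sum_congr rfl p'b]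
    linarith
  have key : ∀ T' ⊆ insert N (β \ T), ∃ T'' ⊆ β, T''.biUnion id = T'.biUnion id ∧
      ∑ c ∈ T'', p c ≤ ∑ c ∈ T', p' c := by
    intro T' hT'
    by_cases hm : N ∈ T'
    · have hsub : T'.erase N ⊆ β \ T := by
        intro c hc
        rw [mem_erase] at hc
        have := hT' hc.2
        rw [mem_insert] at this
        exact this.resolve_left hc.1
      refine ⟨T ∪ T'.erase N, union_subset hT (hsub.trans sdiff_subset), ?_, ?_⟩
      · rw [union_biUnion, ← hN]
        conv_rhs => rw [← insert_erase hm, biUnion_insert]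
        rfl
      · rw [sum_union, ← add_sum_erase T' p' hm, p'N,
          sum_congr rfl (fun b hb => p'b b (hsub hb))]
        · linarith
        · rw [disjoint_left]
          intro c hc hc'
          exact (mem_sdiff.1 (hsub hc')).2 hc
    · have hsub : T' ⊆ β \ T := by
        intro c hc
        have := hT' hc
        rw [mem_insert] at this
        exact this.resolve_left (by rintro rfl; exact hm hc)
      exact ⟨T', hsub.trans sdiff_subset, rfl, (sum_congr rfl (fun b hb => p'b b (hsub hb))).ge⟩
  refine ⟨insert N (β \ T), p', h', ?_, hsum⟩
  refine ⟨?_, ?_, ?_, ?_, ?_, ?_, ?_, ?_, ?_⟩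
  · intro b hb
    rcases mem_insert.1 hb with rfl | hb
    · exact hNe
    · exact A.ne b (mem_sdiff.1 hb).1
  · intro b hb b' hb' hne
    rcases mem_insert.1 hb with rfl | hb <;> rcases mem_insert.1 hb' with rfl | hb'
    · exact absurd rfl hne
    · exact (hdN _ hb').symm
    · exact hdN _ hb
    · exact A.dis b (mem_sdiff.1 hb).1 b' (mem_sdiff.1 hb').1 hne
  · rw [biUnion_insert, ← A.cov]
    conv_rhs => rw [← union_sdiff_of_subset hT, union_biUnion]
    rfl
  · intro b hb
    rcases mem_insert.1 hb with rfl | hb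
    · rw [p'N]
      have := sum_nonneg fun c hc => A.pnn c (hT hc)
      linarith
    · rw [p'b b hb]; exact A.pnn b (mem_sdiff.1 hb).1
  · rw [hsum]; linarith [A.tot]
  · rw [card_insert_of_notMem hNn, card_sdiff_of_subset hT]
    have h1 := card_le_card hT
    have h2 := hTne.card_pos
    have h3 := A.crd
    omega
  · intro b hb hn
    rcases mem_insert.1 hb with rfl | hb
    · rw [h'N] at hn; cases hn
    · rw [h'b b hb] at hn
      rw [p'b b hb]
      exact A.unh b (mem_sdiff.1 hb).1 hn
  · intro b hb b' hb' i hi hi'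
    rcases mem_insert.1 hb with rfl | hb <;> rcases mem_insert.1 hb' with rfl | hb'
    · rfl
    · rw [h'N] at hi; cases hi
      rw [h'b _ hb'] at hi'
      exact absurd hi' (hj _ (mem_sdiff.1 hb').1)
    · rw [h'N] at hi'; cases hi'
      rw [h'b _ hb] at hi
      exact absurd hi (hj _ (mem_sdiff.1 hb).1)
    · rw [h'b _ hb] at hi
      rw [h'b _ hb'] at hi'
      exact A.inj b (mem_sdiff.1 hb).1 b' (mem_sdiff.1 hb').1 i hi hi'
  · intro b hb i hi T' hT'
    obtain ⟨T'', hs, hu, hle⟩ := key T' hT'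
    rw [← hu]
    rcases mem_insert.1 hb with rfl | hb
    · rw [h'N] at hi; cases hi
      rw [p'N]
      linarith [hmax T'' hs]
    · rw [h'b _ hb] at hi
      rw [p'b _ hb]
      linarith [A.opt b (mem_sdiff.1 hb).1 i hi T'' hs]

/-- An approximate clearing equilibrium with additive error `ε`. -/
def ApproxEq {n m : ℕ} (Mk : Market n m) (L C ε : ℝ)
    (β : Finset (Finset (Fin m))) (a : Finset (Fin m) → Fin n)
    (p : Finset (Fin m) → ℝ) : Prop :=
  p ∈ Set.Icc (fun _ => (0:ℝ)) (fun _ => C) ∧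
  L ≤ ∑ b ∈ β, p b ∧
  ∀ i : Fin n, ∀ T : Finset (Finset (Fin m)), T ⊆ β →
    Mk.v i (T.biUnion id) - ∑ b ∈ T, p b ≤
      Mk.v i ((β.filter fun b => a b = i).biUnion id)
        - ∑ b ∈ β.filter fun b => a b = i, p b + ε

def IsPart {m : ℕ} (β : Finset (Finset (Fin m))) : Prop :=
  (∀ b ∈ β, b.Nonempty) ∧ (∀ b ∈ β, ∀ b' ∈ β, b ≠ b' → Disjoint b b') ∧
    β.biUnion id = Finset.univ

lemma exists_approx {n m : ℕ} (hn : 1 ≤ n) {Mk : Market n m} {k : ℕ} {v p0 ε : ℝ}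
    (hp0 : 0 ≤ p0) (hε : 0 < ε) (hε1 : ε ≤ 1) (hεv : ε ≤ v - p0)
    {β₀ : Finset (Finset (Fin m))} {p₀ : Finset (Fin m) → ℝ}
    {h₀ : Finset (Fin m) → Option (Fin n)} (A₀ : AucState Mk k v p0 ε β₀ p₀ h₀) :
    ∃ β a, IsPart β ∧ ∃ p,
      ApproxEq Mk (k * p0) (p0 + 1 + ∑ i, Mk.v i univ) ε β a p := by
  classical
  set W : Set ℝ := {w | ∃ β p h, AucState Mk k v p0 ε β p h ∧ ∑ b ∈ β, p b = w} with hW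
  have hs : 0 ≤ ∑ i, Mk.v i univ := sum_nonneg fun i _ => Mk.nonneg i _
  have hne : W.Nonempty := ⟨_, β₀, p₀, h₀, A₀, rfl⟩
  have hbdd : BddAbove W := by
    refine ⟨k * (p0 + ε + ∑ i, Mk.v i univ), ?_⟩
    rintro w ⟨β, p, h, A, rfl⟩
    calc ∑ b ∈ β, p b ≤ β.card • (p0 + ε + ∑ i, Mk.v i univ) :=
          sum_le_card_nsmul _ _ _ (A.bound hp0 hε.le)
      _ ≤ _ := by
          rw [nsmul_eq_mul]
          have : (β.card : ℝ) ≤ k := by exact_mod_cast A.crd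
          gcongr
  obtain ⟨w, ⟨β, p, h, A, hw⟩, hlt⟩ := exists_lt_of_lt_csSup hne (show sSup W - ε < sSup W by linarith)
  have hnon : ∀ j : Fin n, (∀ b ∈ β, h b ≠ some j) → ∀ T ⊆ β,
      Mk.v j (T.biUnion id) - ∑ c ∈ T, p c < ε := by
    intro j hj
    obtain ⟨T, hT, hmax⟩ := exists_max_image β.powerset
      (fun T => Mk.v j (T.biUnion id) - ∑ c ∈ T, p c) ⟨∅, by simp⟩
    rw [mem_powerset] at hT
    by_contra! hcon
    obtain ⟨T1, hT1, hge⟩ := hcon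
    have hTge := hge.trans (hmax T1 (mem_powerset.2 hT1))
    have hTne : T.Nonempty := by
      rw [nonempty_iff_ne_empty]
      rintro rfl
      simp [Mk.v_empty] at hTge
      linarith
    obtain ⟨β', p', h', A', hsum⟩ := A.step hε j hj T hT hTne
      (fun T' hT' => hmax T' (mem_powerset.2 hT'))
    have : ∑ b ∈ β', p' b ≤ sSup W := le_csSup hbdd ⟨β', p', h', A', rfl⟩
    linarith
  have hheld : ∀ b ∈ β, ∃ i, h b = some i := by
    intro b hb
    by_contra! hcon
    have hnone : h b = none := by
      cases hh : h b with
      | none => rfl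
      | some i => exact absurd hh (hcon i)
    obtain ⟨hp, hcard⟩ := A.unh b hb hnone
    have hsub : ∃ j ∈ (univ.filter fun j => v ≤ Mk.v j b), ∀ c ∈ β, h c ≠ some j := by
      by_contra! hc
      choose! f hf1 hf2 using hc
      have : (univ.filter fun j => v ≤ Mk.v j b).card ≤ (β.erase b).card := by
        apply card_le_card_of_injOn f
        · intro j hj
          rw [mem_coe] at hj
          rw [mem_coe, mem_erase]
          refine ⟨?_, hf1 j hj⟩
          intro he
          have := hf2 j hj
          rw [he, hnone] at this
          cases this
        · intro j hj j' hj' he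
          have h1 := hf2 j hj
          have h2 := hf2 j' hj'
          rw [he, h2] at h1
          exact (Option.some.inj h1).symm
      rw [card_erase_of_mem hb] at this
      have h1 := A.crd
      have h2 : 0 < β.card := card_pos.2 ⟨b, hb⟩
      omega
    obtain ⟨j, hj, hj'⟩ := hsub
    have h1 := hnon j hj' {b} (by simpa using hb)
    have h2 := (mem_filter.1 hj).2
    simp [hp] at h1
    linarith
  let p1 : Finset (Fin m) → ℝ := fun b => if b ∈ β then p b else 0
  have hp1 : ∀ T ⊆ β, ∑ b ∈ T, p1 b = ∑ b ∈ T, p b := fun T hT =>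
    sum_congr rfl fun b hb => by simp [p1, hT hb]
  let a : Finset (Fin m) → Fin n := fun b => (h b).getD ⟨0, hn⟩
  have ha : ∀ b ∈ β, h b = some (a b) := by
    intro b hb
    obtain ⟨i, hi⟩ := hheld b hb
    simp [a, hi]
  refine ⟨β, a, ⟨A.ne, A.dis, A.cov⟩, p1, ⟨?_, ?_⟩, ?_, ?_⟩
  · intro b
    by_cases hb : b ∈ β
    · simpa [p1, hb] using A.pnn b hb
    · simp [p1, hb]
  · intro b
    by_cases hb : b ∈ β
    · have := A.bound hp0 hε.le b hb
      simp only [p1, hb, if_true]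
      linarith
    · simp only [p1, hb, if_false]
      linarith
  · rw [hp1 β subset_rfl]; exact A.tot
  · intro i T hT
    rw [hp1 T hT, hp1 _ (filter_subset _ _)]
    by_cases hi : ∃ b ∈ β, h b = some i
    · obtain ⟨b, hb, hbi⟩ := hi
      have : (β.filter fun b => a b = i) = {b} := by
        ext c
        simp only [mem_filter, mem_singleton]
        constructor
        · rintro ⟨hc, hci⟩
          exact A.inj c hc b hb i (by rw [ha c hc, hci]) hbi
        · rintro rfl
          refine ⟨hb, ?_⟩
          have := ha c hb
          rw [hbi] at this
          exact (Option.some.inj this).symm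
      rw [this]
      simpa using A.opt b hb i hbi T hT
    · push Not at hi
      have : (β.filter fun b => a b = i) = ∅ := by
        rw [filter_eq_empty_iff]
        intro c hc hci
        exact hi c hc (by rw [ha c hc, hci])
      rw [this]
      simpa [Mk.v_empty] using (hnon i hi T hT).le

lemma exists_exact {n m : ℕ} {Mk : Market n m} {L C ε₀ : ℝ} (hε₀ : 0 < ε₀)
    (H : ∀ ε, 0 < ε → ε ≤ ε₀ → ∃ β a, IsPart β ∧ ∃ p, ApproxEq Mk L C ε β a p) :
    ∃ β a, IsPart β ∧ ∃ p, ApproxEq Mk L C 0 β a p := by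
  classical
  have mono : ∀ {ε ε' β a p}, ε ≤ ε' → ApproxEq Mk L C ε β a p → ApproxEq Mk L C ε' β a p := by
    intro ε ε' β a p hle hA
    exact ⟨hA.1, hA.2.1, fun i T hT => (hA.2.2 i T hT).trans (by linarith)⟩
  have hfix : ∃ x : Finset (Finset (Fin m)) × (Finset (Fin m) → Fin n),
      ∀ ε, 0 < ε → IsPart x.1 ∧ ∃ p, ApproxEq Mk L C ε x.1 x.2 p := by
    by_contra! hcon
    choose e he hne using hcon
    obtain ⟨β₁, a₁, -⟩ := H ε₀ hε₀ le_rfl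
    obtain ⟨x₀, -, hx₀⟩ := exists_min_image
      (univ : Finset (Finset (Finset (Fin m)) × (Finset (Fin m) → Fin n))) e ⟨(β₁, a₁), mem_univ _⟩
    obtain ⟨β, a, hP, p, hA⟩ := H (min ε₀ (e x₀)) (lt_min hε₀ (he _)) (min_le_left _ _)
    exact hne (β, a) hP p (mono ((min_le_right _ _).trans (hx₀ _ (mem_univ _))) hA)
  obtain ⟨⟨β, a⟩, hx⟩ := hfix
  refine ⟨β, a, (hx 1 one_pos).1, ?_⟩
  let K : ℕ → Set (Finset (Fin m) → ℝ) := fun q => {p | ApproxEq Mk L C (1 / ((q:ℝ) + 1)) β a p}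
  have hclosed : ∀ q, IsClosed (K q) := by
    intro q
    have : K q = Set.Icc (fun _ => (0:ℝ)) (fun _ => C) ∩ ({p | L ≤ ∑ b ∈ β, p b} ∩
      ⋂ i : Fin n, ⋂ T : Finset (Finset (Fin m)), ⋂ _ : T ⊆ β,
        {p | Mk.v i (T.biUnion id) - ∑ b ∈ T, p b ≤
      Mk.v i ((β.filter fun b => a b = i).biUnion id)
        - ∑ b ∈ β.filter fun b => a b = i, p b + 1 / ((q:ℝ) + 1)}) := by
      ext p
      simp only [K, ApproxEq, Set.mem_ofPred_eq, Set.mem_inter_iff, Set.mem_iInter]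
    rw [this]
    refine isClosed_Icc.inter ((isClosed_le (by fun_prop) (by fun_prop)).inter ?_)
    refine isClosed_iInter fun i => isClosed_iInter fun T => isClosed_iInter fun _ => ?_
    exact isClosed_le (by fun_prop) (by fun_prop)
  have hcomp : IsCompact (K 0) :=
    IsCompact.of_isClosed_subset isCompact_Icc (hclosed 0) (fun p hp => hp.1)
  obtain ⟨p, hp⟩ := IsCompact.nonempty_iInter_of_sequence_nonempty_isCompact_isClosed K
    (fun q p hp => mono (by
      apply one_div_le_one_div_of_le
      · positivity
      · push_cast; linarith) hp)
    (fun q => (hx _ (by positivity)).2) hcomp hclosed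
  rw [Set.mem_iInter] at hp
  refine ⟨p, (hp 0).1, (hp 0).2.1, fun i T hT => ?_⟩
  rw [add_zero]
  refine le_of_forall_pos_le_add fun ε hε => ?_
  obtain ⟨q, hq⟩ := exists_nat_one_div_lt hε
  exact ((hp q).2.2 i T hT).trans (by linarith)

/-- From bundles with many interested consumers to an exact equilibrium. -/
lemma exists_cbe {n m : ℕ} (hn : 1 ≤ n) (Mk : Market n m) (k : ℕ) (v p0 : ℝ)
    (hp0 : 0 ≤ p0) (hpv : p0 < v) (G : Fin k → Finset (Fin m))
    (hG : ∀ g, (G g).Nonempty) (hd : ∀ g g', g ≠ g' → Disjoint (G g) (G g'))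
    (hc : ∀ x, ∃ g, x ∈ G g)
    (hk : ∀ g, k ≤ (univ.filter fun j => v ≤ Mk.v j (G g)).card) :
    ∃ E : CBE Mk, k * p0 ≤ E.welfare := by
  classical
  have Ginj : Function.Injective G := by
    intro g g' he
    by_contra hne
    have := hd g g' hne
    rw [← he, disjoint_self_iff_empty] at this
    exact (hG g).ne_empty this
  have hcard : (univ.image G).card = k := by simp [card_image_of_injective _ Ginj]
  have A₀ : ∀ ε, 0 < ε → AucState Mk k v p0 ε (univ.image G) (fun _ => p0) (fun _ => none) := by
    intro ε hε
    refine ⟨?_, ?_, ?_, fun _ _ => hp0, ?_, hcard.le, ?_, ?_, ?_⟩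
    · simpa using hG
    · intro b hb b' hb' hne
      obtain ⟨g, -, rfl⟩ := mem_image.1 hb
      obtain ⟨g', -, rfl⟩ := mem_image.1 hb'
      exact hd g g' (fun h => hne (by rw [h]))
    · ext x
      simpa using hc x
    · simp [hcard]
    · intro b hb _
      obtain ⟨g, -, rfl⟩ := mem_image.1 hb
      exact ⟨rfl, hk g⟩
    · intro b _ b' _ i h; cases h
    · intro b _ i h; cases h
  obtain ⟨β, a, hP, p, h1, h2, h3⟩ := exists_exact (Mk := Mk) (L := k * p0)
    (C := p0 + 1 + ∑ i, Mk.v i univ) (ε₀ := min 1 (v - p0)) (lt_min one_pos (by linarith))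
    (fun ε hε hle => exists_approx hn hp0 hε (hle.trans (min_le_left _ _))
      (hle.trans (min_le_right _ _)) (A₀ ε hε))
  refine ⟨⟨β, p, a, hP.1, hP.2.1, hP.2.2, fun b _ => h1.1 b, fun i T hT => ?_⟩, ?_⟩
  · have := h3 i T hT
    linarith
  · refine h2.trans ?_
    unfold CBE.welfare
    rw [← sum_fiberwise β a p]
    refine sum_le_sum fun i _ => ?_
    have := h3 i ∅ (empty_subset _)
    simp only [biUnion_empty, Mk.v_empty, sum_empty] at this
    linarith

/-- If `(S_1, …, S_r)` are pairwise disjoint nonempty bundles with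
`v_i(S_i) ∈ [v, 2v)` for `i = 1, …, r`, then there is a CBE with welfare at least
`(∑ i, v_i(S_i)) / (4√r + 4)`. -/
theorem sqrt_r_conversion (n m : ℕ) (hn : 1 ≤ n) (hm : 1 ≤ m) (Mk : Market n m)
    (v : ℝ) (hv : 0 < v) (r : ℕ) (hr : 1 ≤ r) (hrn : r ≤ n)
    (S : Fin r → Finset (Fin m))
    (hdisj : ∀ i j : Fin r, i ≠ j → Disjoint (S i) (S j))
    (hne : ∀ i, (S i).Nonempty)
    (hval : ∀ i : Fin r, Mk.v (Fin.castLE hrn i) (S i) ∈ Set.Ico v (2 * v)) :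
    ∃ E : CBE Mk,
      E.welfare ≥ (∑ i, Mk.v (Fin.castLE hrn i) (S i)) / (4 * Real.sqrt r + 4) := by
  classical
  set k := Nat.sqrt r with hkdef
  have hkk : k * k ≤ r := Nat.sqrt_le r
  have hk1 : 1 ≤ k := Nat.sqrt_pos.2 hr
  have hkr : r < (k + 1) * (k + 1) := Nat.lt_succ_sqrt r
  set s := Real.sqrt r with hs
  have hs0 : 0 < s := Real.sqrt_pos.2 (by exact_mod_cast hr)
  have hss : s * s = r := Real.mul_self_sqrt (by positivity)
  have hsk : s < k + 1 := by
    have h1 : (r:ℝ) < (k + 1) * (k + 1) := by exact_mod_cast hkr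
    nlinarith
  have hk1' : (1:ℝ) ≤ k := by exact_mod_cast hk1
  let c : Fin r → Fin k := fun i => ⟨i % k, Nat.mod_lt _ hk1⟩
  let f : Fin m → Fin k := fun x => if h : ∃ i, x ∈ S i then c h.choose else ⟨0, hk1⟩
  have hf : ∀ i, ∀ x ∈ S i, f x = c i := by
    intro i x hx
    have h : ∃ i, x ∈ S i := ⟨i, hx⟩
    have he : h.choose = i := by
      by_contra hne
      exact (disjoint_left.1 (hdisj _ _ hne)) h.choose_spec hx
    simp only [f, dif_pos h, he]
  let G : Fin k → Finset (Fin m) := fun g => univ.filter fun x => f x = g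
  have hSG : ∀ i, S i ⊆ G (c i) := fun i x hx => by simp [G, hf i x hx]
  have hlt : ∀ (g t : Fin k), (g : ℕ) + t * k < r := by
    intro g t
    have h1 : ((t:ℕ) + 1) * k ≤ k * k := Nat.mul_le_mul_right _ t.2
    have h2 := g.2
    nlinarith
  let ι : Fin k → Fin k → Fin r := fun g t => ⟨(g : ℕ) + t * k, hlt g t⟩
  have hι : ∀ g t, c (ι g t) = g := by
    intro g t
    apply Fin.ext
    simp [c, ι, Nat.mod_eq_of_lt g.2]
  have hιinj : ∀ g, Function.Injective (ι g) := by
    intro g t t' h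
    have h1 := congrArg Fin.val h
    simp only [ι] at h1
    have h2 : (t:ℕ) * k = t' * k := by omega
    exact Fin.ext (Nat.eq_of_mul_eq_mul_right hk1 h2)
  have hp : v * (s / (s + 1)) < v := by
    have : s / (s + 1) < 1 := by rw [div_lt_one (by linarith)]; linarith
    nlinarith
  obtain ⟨E, hE⟩ := exists_cbe hn Mk k v (v * (s / (s + 1))) (by positivity) hp G
    (fun g => by
      have h := (hne (ι g ⟨0, hk1⟩)).mono (hSG _)
      rwa [hι] at h)
    (fun g g' hgg => by
      rw [disjoint_left]
      intro x hx hx'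
      simp only [G, mem_filter, mem_univ, true_and] at hx hx'
      exact hgg (hx.symm.trans hx'))
    (fun x => ⟨f x, by simp [G]⟩)
    (fun g => by
      calc k = (univ.image (Fin.castLE hrn ∘ ι g)).card := by
            rw [card_image_of_injective _ ((Fin.castLE_injective hrn).comp (hιinj g))]
            simp
        _ ≤ _ := by
            apply card_le_card
            intro j hj
            obtain ⟨t, -, rfl⟩ := mem_image.1 hj
            rw [mem_filter]
            refine ⟨mem_univ _, (hval (ι g t)).1.trans (Mk.v_mono _ _ _ ?_)⟩
            have h := hSG (ι g t)
            rwa [hι] at h)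
  refine ⟨E, le_trans ?_ hE⟩
  have hsum : ∑ i, Mk.v (Fin.castLE hrn i) (S i) ≤ r * (2 * v) := by
    calc _ ≤ ∑ _i : Fin r, 2 * v := sum_le_sum fun i _ => (hval i).2.le
      _ = _ := by simp
  calc _ ≤ (r * (2 * v)) / (4 * s + 4) := by gcongr
    _ = s / 2 * (v * (s / (s + 1))) := by
        rw [← hss]; field_simp; ring
    _ ≤ k * (v * (s / (s + 1))) := by
        gcongr
        linarith
end
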